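/- arXiv:2209.14461 — 4 statements merged into one kernel-verified Lean document; each statement's English description precedes it below -/
import Mathlib

section
/- Let x : ℝ → ℝ^n be differentiable, let h : ℝ^n → ℝ be continuously differentiable, and let γ > 0. Suppose that for all t ≥ 0, (d/dt) h(x(t)) ≥ −γ h(x(t)), and that h(x(0)) ≥ 0. Then h(x(t)) ≥ 0 for all t ≥ 0; that is, the trajectory remains in the superlevel set C = {x ∈ ℝ^n : h(x) ≥ 0}. -/
/-- Comparison with an exponential: if `f' ≥ -γ f` on `[0, ∞)`, then `f t ≥ f 0 * exp (-γ t)`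
for `t ≥ 0`. -/
theorem mul_exp_neg_le_of_neg_mul_le_deriv {f : ℝ → ℝ} {γ : ℝ} (hf : Differentiable ℝ f)
    (hderiv : ∀ t, 0 ≤ t → -γ * f t ≤ deriv f t) {t : ℝ} (ht : 0 ≤ t) :
    f 0 * Real.exp (-γ * t) ≤ f t := by
  have hg (s : ℝ) : HasDerivAt (fun τ => Real.exp (γ * τ) * f τ)
      (Real.exp (γ * s) * (γ * f s + deriv f s)) s := by
    have he : HasDerivAt (fun τ => Real.exp (γ * τ)) (Real.exp (γ * s) * (γ * 1)) s :=
      ((hasDerivAt_id' s).const_mul γ).exp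
    refine (he.mul (hf s).hasDerivAt).congr_deriv ?_
    ring
  have hmono : MonotoneOn (fun τ => Real.exp (γ * τ) * f τ) (Set.Ici 0) := by
    refine monotoneOn_of_deriv_nonneg (convex_Ici 0)
      (fun s _ => (hg s).continuousAt.continuousWithinAt)
      (fun s _ => (hg s).differentiableAt.differentiableWithinAt) fun s hs => ?_
    rw [(hg s).deriv]
    exact mul_nonneg (Real.exp_pos _).le (by linarith [hderiv s (interior_subset hs)])
  have h0t : f 0 ≤ Real.exp (γ * t) * f t := by
    simpa using hmono Set.self_mem_Ici ht ht
  calc f 0 * Real.exp (-γ * t) ≤ Real.exp (γ * t) * f t * Real.exp (-γ * t) := by gcongr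
    _ = f t := by
      rw [mul_right_comm, ← Real.exp_add]
      simp

/-- If `h` is a continuously differentiable zeroing barrier function along the
differentiable trajectory `x`, i.e. `(d/dt) h (x t) ≥ -γ * h (x t)` for all `t ≥ 0` with `γ > 0`,
and `h (x 0) ≥ 0`, then the trajectory remains in the superlevel set `C = {p | h p ≥ 0}`. -/
theorem zbf_forward_invariance_nonneg {n : ℕ}
    (x : ℝ → EuclideanSpace ℝ (Fin n)) (hx : Differentiable ℝ x)
    (h : EuclideanSpace ℝ (Fin n) → ℝ) (hh : ContDiff ℝ 1 h)
    (γ : ℝ) (hγ : 0 < γ)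
    (hzbf : ∀ t : ℝ, 0 ≤ t → deriv (fun τ => h (x τ)) t ≥ -γ * h (x t))
    (h0 : 0 ≤ h (x 0)) :
    ∀ t : ℝ, 0 ≤ t → x t ∈ {p : EuclideanSpace ℝ (Fin n) | 0 ≤ h p} := by
  intro t ht
  have hf : Differentiable ℝ (fun τ => h (x τ)) := (hh.differentiable one_ne_zero).comp hx
  exact (mul_nonneg h0 (Real.exp_pos _).le).trans
    (mul_exp_neg_le_of_neg_mul_le_deriv hf hzbf ht)
end

section
/- Let φ : ℝ → ℝ be differentiable and let α : ℝ → ℝ be a strictly increasing continuous function with α(0) = 0 (an extended class-K function). If φ(0) ≥ 0 and φ'(t) ≥ −α(φ(t)) for all t ≥ 0, then φ(t) ≥ 0 for all t ≥ 0. -/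
/-- Comparison lemma for an extended class-K function `α` (strictly increasing,
continuous, `α 0 = 0`): if `φ` is differentiable with `φ 0 ≥ 0` and `φ' t ≥ -α (φ t)` for all
`t ≥ 0`, then `φ t ≥ 0` for all `t ≥ 0`. -/
theorem classK_comparison_nonneg
    (φ : ℝ → ℝ) (hφ : Differentiable ℝ φ)
    (α : ℝ → ℝ) (hα_mono : StrictMono α) (hα_cont : Continuous α) (hα0 : α 0 = 0)
    (h0 : 0 ≤ φ 0)
    (hineq : ∀ t : ℝ, 0 ≤ t → deriv φ t ≥ -α (φ t)) :
    ∀ t : ℝ, 0 ≤ t → 0 ≤ φ t := by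
  intro t ht
  refine le_of_forall_pos_le_add fun ε hε => ?_
  have key : -φ t ≤ ε :=
    image_le_of_deriv_right_lt_deriv_boundary (f := fun s => -φ s) (f' := fun s => -deriv φ s)
      (B := fun _ => ε) (B' := fun _ => 0) (a := 0) (b := t)
      hφ.continuous.neg.continuousOn
      (fun s _ => (hφ s).hasDerivAt.neg.hasDerivWithinAt)
      (by linarith) (fun s => hasDerivAt_const s ε)
      (fun s hs hs_eq => by
        have hneg : α (φ s) < 0 := hα0 ▸ hα_mono (by linarith : φ s < 0)
        linarith [hineq s hs.1])
      (Set.right_mem_Icc.mpr ht)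
  linarith
end

section
/- Let k > 0. The function (d₁, d₂) ↦ smin(d₁, d₂, k) = min(d₁, d₂) − k·(1/6)·(max(k − |d₁ − d₂|, 0)/k)³ is twice continuously differentiable on ℝ² (it is C², even across the diagonal d₁ = d₂ where min itself fails to be differentiable, and across the locus |d₁ − d₂| = k). -/
/-- The smooth-minimum operation with blending radius `k`. -/
noncomputable def smin (d₁ d₂ k : ℝ) : ℝ :=
  min d₁ d₂ - k * (1 / 6) * (max (k - |d₁ - d₂|) 0 / k) ^ 3

theorem hasDerivAt_max_zero_pow (n : ℕ) (x : ℝ) :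
    HasDerivAt (fun t : ℝ => max t 0 ^ (n + 2)) ((n + 2 : ℝ) * max x 0 ^ (n + 1)) x := by
  have hpow : HasDerivAt (fun t : ℝ => t ^ (n + 2)) ((n + 2 : ℝ) * x ^ (n + 1)) x := by
    simpa using hasDerivAt_pow (n + 2) x
  rcases lt_trichotomy x 0 with hx | rfl | hx
  · rw [max_eq_right hx.le, zero_pow n.succ_ne_zero, mul_zero]
    refine (hasDerivAt_const x (0 : ℝ)).congr_of_eventuallyEq ?_
    filter_upwards [gt_mem_nhds hx] with t ht
    simp [max_eq_right ht.le]
  · rw [max_self, ← hasDerivWithinAt_univ, ← Set.Iic_union_Ici (a := (0 : ℝ))]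
    refine HasDerivWithinAt.union ?_ ?_
    · rw [zero_pow n.succ_ne_zero, mul_zero]
      refine (hasDerivWithinAt_const 0 _ (0 : ℝ)).congr_of_mem (fun t ht => ?_) Set.self_mem_Iic
      simp [max_eq_right (Set.mem_Iic.1 ht)]
    · refine hpow.hasDerivWithinAt.congr_of_mem (fun t ht => ?_) Set.self_mem_Ici
      simp only [max_eq_left (Set.mem_Ici.1 ht)]
  · rw [max_eq_left hx.le]
    refine hpow.congr_of_eventuallyEq ?_
    filter_upwards [lt_mem_nhds hx] with t ht
    simp only [max_eq_left ht.le]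

theorem contDiff_max_zero_pow (n : ℕ) : ContDiff ℝ n (fun t : ℝ => max t 0 ^ (n + 1)) := by
  induction n with
  | zero => exact contDiff_zero.2 (by fun_prop)
  | succ n ih =>
    have hd : deriv (fun t : ℝ => max t 0 ^ (n + 2)) =
        fun t => (n + 2 : ℝ) * max t 0 ^ (n + 1) :=
      funext fun x => (hasDerivAt_max_zero_pow n x).deriv
    push_cast
    refine contDiff_succ_iff_deriv.2
      ⟨fun x => (hasDerivAt_max_zero_pow n x).differentiableAt, by simp, ?_⟩
    rw [hd]
    exact contDiff_const.mul ih

/-- The smooth minimum as a cubic spline in `d₁ - d₂` with knots `-k`, `0` and `k`. -/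
theorem smin_eq_spline {k : ℝ} (hk : 0 < k) (d₁ d₂ : ℝ) :
    smin d₁ d₂ k = d₁ - (max (d₁ - d₂ + k) 0 ^ 3 - 2 * max (d₁ - d₂) 0 ^ 3
      + max (d₁ - d₂ - k) 0 ^ 3) / (6 * k ^ 2) := by
  obtain ⟨u, rfl⟩ : ∃ u, d₁ = d₂ + u := ⟨d₁ - d₂, by ring⟩
  simp only [smin, add_sub_cancel_left]
  rcases le_total u 0 with hu | hu
  · rw [abs_of_nonpos hu, min_eq_left (by linarith), max_eq_right hu,
      max_eq_right (by linarith : u - k ≤ 0), sub_neg_eq_add, add_comm k u]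
    field_simp
    ring
  · rw [abs_of_nonneg hu, min_eq_right (by linarith), max_eq_left hu,
      max_eq_left (by linarith : 0 ≤ u + k)]
    rcases le_total u k with huk | huk
    · rw [max_eq_left (by linarith : 0 ≤ k - u), max_eq_right (by linarith : u - k ≤ 0)]
      field_simp
      ring
    · rw [max_eq_right (by linarith : k - u ≤ 0), max_eq_left (by linarith : 0 ≤ u - k)]
      field_simp
      ring

/-- For `k > 0`, the smooth minimum `(d₁, d₂) ↦ smin d₁ d₂ k` is twice
continuously differentiable on `ℝ²`. -/
theorem smin_contDiff_two (k : ℝ) (hk : 0 < k) :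
    ContDiff ℝ 2 (fun p : ℝ × ℝ => smin p.1 p.2 k) := by
  have hc : ContDiff ℝ 2 (fun t : ℝ => max t 0 ^ 3) := contDiff_max_zero_pow 2
  have hd : ContDiff ℝ 2 (fun p : ℝ × ℝ => p.1 - p.2) := contDiff_fst.sub contDiff_snd
  simp only [smin_eq_spline hk]
  exact contDiff_fst.sub ((((hc.comp (hd.add contDiff_const)).sub
    (contDiff_const.mul (hc.comp hd))).add (hc.comp (hd.sub contDiff_const))).div_const _)
end

section
/- Let τ, α_z, β_z > 0 and g ∈ ℝ^n, and let z, y : ℝ → ℝ^n be differentiable functions satisfying the unforced DMP transformation system τ ż(t) = α_z(β_z(g − y(t)) − z(t)) and τ ẏ(t) = z(t). Then y(t) → g and z(t) → 0 as t → ∞; that is, the spring-damper transformation system is globally attracted to the goal state (z, y) = (0, g). -/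
/-- A nonnegative function with `V' ≤ -k V`, `k > 0`, tends to zero at infinity. -/
theorem tendsto_zero_of_deriv_le_neg_mul {V V' : ℝ → ℝ} {k : ℝ} (hk : 0 < k)
    (hV : ∀ t, HasDerivAt V (V' t) t) (hnonneg : ∀ t, 0 ≤ V t) (hle : ∀ t, V' t ≤ -k * V t) :
    Filter.Tendsto V Filter.atTop (nhds 0) := by
  have hderiv (t : ℝ) : HasDerivAt (fun s => V s * Real.exp (k * s))
      ((V' t + k * V t) * Real.exp (k * t)) t := by
    have he : HasDerivAt (fun s => Real.exp (k * s)) (Real.exp (k * t) * k) t := by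
      simpa using ((hasDerivAt_id t).const_mul k).exp
    exact ((hV t).mul he).congr_deriv (by ring)
  have hanti : Antitone fun s => V s * Real.exp (k * s) :=
    antitone_of_hasDerivAt_nonpos hderiv fun t =>
      mul_nonpos_of_nonpos_of_nonneg (by linarith [hle t]) (Real.exp_pos _).le
  have hexp : Filter.Tendsto (fun t => V 0 * Real.exp (-(k * t))) Filter.atTop (nhds 0) := by
    simpa using (Real.tendsto_exp_neg_atTop_nhds_zero.comp
      (Filter.tendsto_id.const_mul_atTop hk)).const_mul (V 0)
  refine tendsto_of_tendsto_of_tendsto_of_le_of_le' tendsto_const_nhds hexp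
    (Filter.Eventually.of_forall hnonneg) ?_
  filter_upwards [Filter.eventually_ge_atTop 0] with t ht
  have h : V t * Real.exp (k * t) ≤ V 0 := by simpa using hanti ht
  rwa [Real.exp_neg, ← div_eq_mul_inv, le_div_iff₀ (Real.exp_pos _)]

/-- If `c * ‖f‖ ^ 2` is dominated by a function tending to zero and `c > 0`, then `f` tends
to zero. -/
theorem tendsto_zero_of_mul_norm_sq_le {E : Type*} [NormedAddCommGroup E] {f : ℝ → E}
    {V : ℝ → ℝ} {c : ℝ} (hc : 0 < c) (hle : ∀ t, c * ‖f t‖ ^ 2 ≤ V t)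
    (hV : Filter.Tendsto V Filter.atTop (nhds 0)) :
    Filter.Tendsto f Filter.atTop (nhds 0) := by
  have hsq : Filter.Tendsto (fun t => ‖f t‖ ^ 2) Filter.atTop (nhds 0) := by
    refine squeeze_zero (fun t => sq_nonneg _) (fun t => ?_) (by simpa using hV.div_const c)
    rw [le_div_iff₀ hc, mul_comm]
    exact hle t
  rw [tendsto_zero_iff_norm_tendsto_zero]
  simpa using hsq.sqrt

/-- Solutions of the damped oscillator `x' = a z`, `z' = -a α (β x + z)` with `a, α, β > 0` tend
to the origin. -/
theorem damped_oscillator_tendsto_zero {E : Type*} [NormedAddCommGroup E] [InnerProductSpace ℝ E]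
    {a α β : ℝ} (ha : 0 < a) (hα : 0 < α) (hβ : 0 < β) {x z : ℝ → E}
    (hx : ∀ t, HasDerivAt x (a • z t) t)
    (hz : ∀ t, HasDerivAt z (-(a * α) • (β • x t + z t)) t) :
    Filter.Tendsto x Filter.atTop (nhds 0) ∧ Filter.Tendsto z Filter.atTop (nhds 0) := by
  set V : ℝ → ℝ := fun t => ‖z t‖ ^ 2 + ‖z t + α • x t‖ ^ 2 + 2 * α * β * ‖x t‖ ^ 2 with hVdef
  have hV (t : ℝ) : HasDerivAt V
      (-(2 * a * α) * ‖z t‖ ^ 2 - 2 * a * α ^ 2 * β * ‖x t‖ ^ 2) t := by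
    refine (((hz t).norm_sq.add ((hz t).add ((hx t).const_smul α)).norm_sq).add
      ((hx t).norm_sq.const_mul (2 * α * β))).congr_deriv ?_
    simp only [Pi.add_apply, Pi.smul_apply, inner_add_left, inner_add_right, real_inner_smul_left,
      real_inner_smul_right, real_inner_self_eq_norm_sq, real_inner_comm (x t) (z t)]
    ring
  have hlim : Filter.Tendsto V Filter.atTop (nhds 0) := by
    refine tendsto_zero_of_deriv_le_neg_mul (k := a * α * β / (2 * (α + β))) (by positivity) hV
      (fun t => by positivity) fun t => ?_
    have hsum : ‖z t + α • x t‖ ^ 2 ≤ 2 * ‖z t‖ ^ 2 + 2 * α ^ 2 * ‖x t‖ ^ 2 := by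
      have h := parallelogram_law_with_norm ℝ (z t) (α • x t)
      rw [norm_smul, Real.norm_of_nonneg hα.le] at h
      nlinarith [mul_self_nonneg ‖z t - α • x t‖]
    have hbound : V t ≤ 3 * ‖z t‖ ^ 2 + 2 * α * (α + β) * ‖x t‖ ^ 2 := by
      simp only [hVdef]
      linarith
    have hrate : a * α * β / (2 * (α + β)) * (3 * ‖z t‖ ^ 2 + 2 * α * (α + β) * ‖x t‖ ^ 2) ≤
        2 * a * α * ‖z t‖ ^ 2 + 2 * a * α ^ 2 * β * ‖x t‖ ^ 2 := by
      rw [div_mul_eq_mul_div, div_le_iff₀ (by positivity), ← sub_nonneg]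
      have hdiff : (2 * a * α * ‖z t‖ ^ 2 + 2 * a * α ^ 2 * β * ‖x t‖ ^ 2) * (2 * (α + β)) -
          a * α * β * (3 * ‖z t‖ ^ 2 + 2 * α * (α + β) * ‖x t‖ ^ 2) =
          a * α * (4 * α + β) * ‖z t‖ ^ 2 + 2 * a * α ^ 2 * β * (α + β) * ‖x t‖ ^ 2 := by
        ring
      rw [hdiff]
      positivity
    have hmul := mul_le_mul_of_nonneg_left hbound
      (show 0 ≤ a * α * β / (2 * (α + β)) by positivity)
    linarith
  constructor
  · refine tendsto_zero_of_mul_norm_sq_le (c := 2 * α * β) (by positivity) (fun t => ?_) hlim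
    simp only [hVdef]
    linarith [sq_nonneg ‖z t‖, sq_nonneg ‖z t + α • x t‖]
  · refine tendsto_zero_of_mul_norm_sq_le one_pos (fun t => ?_) hlim
    have h : 0 ≤ 2 * α * β * ‖x t‖ ^ 2 := by positivity
    simp only [hVdef]
    linarith [sq_nonneg ‖z t + α • x t‖]

/-- The unforced DMP transformation system
`τ ż = α_z • (β_z • (g - y) - z)`, `τ ẏ = z` with `τ, α_z, β_z > 0` is globally attracted to
the goal state `(z, y) = (0, g)`: every differentiable solution satisfies `y t → g` and
`z t → 0` as `t → ∞`. -/
theorem unforced_transformation_system_converges {n : ℕ}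
    (τ αz βz : ℝ) (hτ : 0 < τ) (hαz : 0 < αz) (hβz : 0 < βz)
    (g : EuclideanSpace ℝ (Fin n))
    (z y : ℝ → EuclideanSpace ℝ (Fin n))
    (hz : Differentiable ℝ z) (hy : Differentiable ℝ y)
    (hode_z : ∀ t : ℝ, τ • deriv z t = αz • (βz • (g - y t) - z t))
    (hode_y : ∀ t : ℝ, τ • deriv y t = z t) :
    Filter.Tendsto y Filter.atTop (nhds g) ∧
    Filter.Tendsto z Filter.atTop (nhds 0) := by
  have hx (t : ℝ) : HasDerivAt (fun s => y s - g) (τ⁻¹ • z t) t := by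
    refine ((hy t).hasDerivAt.sub_const g).congr_deriv ?_
    rw [← hode_y t, inv_smul_smul₀ hτ.ne']
  have hz' (t : ℝ) : HasDerivAt z (-(τ⁻¹ * αz) • (βz • (y t - g) + z t)) t := by
    refine (hz t).hasDerivAt.congr_deriv ?_
    rw [← inv_smul_smul₀ hτ.ne' (deriv z t), hode_z t]
    module
  obtain ⟨hxlim, hzlim⟩ := damped_oscillator_tendsto_zero (inv_pos.2 hτ) hαz hβz hx hz'
  exact ⟨tendsto_sub_nhds_zero_iff.1 hxlim, hzlim⟩
end
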